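/- Let G be a group with a bi-invariant metric d. Let r : G → ℝ be a homogeneous quasimorphism, and suppose that for every ε > 0 there exists δ > 0 such that every g ∈ G with d(g, 1) ≤ δ satisfies |r(g)| ≤ ε (continuity of r at the identity). Then there exists a constant C ≥ 0 such that for all g ∈ G and all h ∈ G with 0 < d(h, 1) ≤ δ(1) (where δ(1) is a value of δ corresponding to ε = 1), one has |r(hg) − r(g)| ≤ C · d(hg, g); that is, r is Lipschitz on each coset locally near every point of G at scale δ(1). -/

import Mathlib

/-- For a bi-invariant metric, `n`-th powers are `n`-Lipschitz. -/
theorem dist_pow_pow_le_of_biinvariant {G : Type*} [Group G] [PseudoMetricSpace G]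
    (hleft : ∀ k g h : G, dist (k * g) (k * h) = dist g h)
    (hright : ∀ g h k : G, dist (g * k) (h * k) = dist g h) (x y : G) (n : ℕ) :
    dist (x ^ n) (y ^ n) ≤ n * dist x y := by
  induction n with
  | zero => simp
  | succ n ih =>
    calc dist (x ^ (n + 1)) (y ^ (n + 1))
        ≤ dist (x ^ n * x) (y ^ n * x) + dist (y ^ n * x) (y ^ n * y) := by
          rw [pow_succ, pow_succ]
          exact dist_triangle _ _ _
      _ = dist (x ^ n) (y ^ n) + dist x y := by rw [hright, hleft]
      _ ≤ (n + 1 : ℕ) * dist x y := by push_cast; linarith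

/-- For a bi-invariant metric on a group and a homogeneous quasimorphism `r` that is
continuous at the identity, there is a scale `δ = δ(1)` (a value of `δ` corresponding
to `ε = 1`) and a constant `C ≥ 0` such that `|r(hg) − r(g)| ≤ C·d(hg, g)` whenever
`0 < d(h,1) ≤ δ`: `r` is Lipschitz locally near every point of `G` at scale `δ(1)`. -/
theorem quasimorphism_locally_lipschitz_of_continuous_at_one
    {G : Type*} [Group G] [MetricSpace G]
    (hleft : ∀ k g h : G, dist (k * g) (k * h) = dist g h)
    (hright : ∀ g h k : G, dist (g * k) (h * k) = dist g h)
    (r : G → ℝ)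
    (hquasi : ∃ D : ℝ, 0 ≤ D ∧ ∀ f g : G, |r (f * g) - r f - r g| ≤ D)
    (hhom : ∀ (g : G) (m : ℤ), r (g ^ m) = m * r g)
    (hcont : ∀ ε : ℝ, 0 < ε → ∃ δ : ℝ, 0 < δ ∧ ∀ g : G, dist g 1 ≤ δ → |r g| ≤ ε) :
    ∃ δ : ℝ, 0 < δ ∧ (∀ g : G, dist g 1 ≤ δ → |r g| ≤ 1) ∧
      ∃ C : ℝ, 0 ≤ C ∧ ∀ g h : G, 0 < dist h 1 → dist h 1 ≤ δ →
        |r (h * g) - r g| ≤ C * dist (h * g) g := by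
  obtain ⟨D, hD, hr⟩ := hquasi
  obtain ⟨δ, hδ, hδr⟩ := hcont 1 one_pos
  refine ⟨δ, hδ, hδr, 2 * (1 + D) / δ, by positivity, fun g h hpos hle => ?_⟩
  have hdist : dist (h * g) g = dist h 1 := by simpa using hright h 1 g
  rw [hdist]
  set d := dist h 1
  set n := ⌊δ / d⌋₊
  have hn : (1 : ℝ) ≤ n := by
    exact_mod_cast (Nat.one_le_floor_iff _).2 ((one_le_div hpos).2 hle)
  have hnδ : n * d ≤ δ := (le_div_iff₀ hpos).1 (Nat.floor_le (by positivity))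
  have hδn : δ < (n + 1) * d := (div_lt_iff₀ hpos).1 (Nat.lt_floor_add_one _)
  have hk : dist ((h * g) ^ n * (g ^ n)⁻¹) 1 ≤ δ := by
    have hcancel := hright ((h * g) ^ n) (g ^ n) (g ^ n)⁻¹
    rw [mul_inv_cancel] at hcancel
    have hpow := dist_pow_pow_le_of_biinvariant hleft hright (h * g) g n
    rw [hdist] at hpow
    linarith
  have hkr := abs_le.1 (hδr _ hk)
  have hq := abs_le.1 (hr ((h * g) ^ n * (g ^ n)⁻¹) (g ^ n))
  rw [inv_mul_cancel_right] at hq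
  have hpow (x : G) : r (x ^ n) = n * r x := by simpa using hhom x n
  rw [hpow, hpow] at hq
  have hmul : n * |r (h * g) - r g| ≤ 1 + D := by
    rw [← abs_of_nonneg (Nat.cast_nonneg (α := ℝ) n), ← abs_mul, abs_le]
    constructor <;> linarith
  rw [div_mul_eq_mul_div, le_div_iff₀ hδ]
  calc |r (h * g) - r g| * δ ≤ |r (h * g) - r g| * (2 * n * d) := by
        gcongr
        nlinarith
    _ = 2 * (n * |r (h * g) - r g|) * d := by ring
    _ ≤ 2 * (1 + D) * d := by gcongr
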